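/- arXiv:0908.0428 — 2 statements merged into one kernel-verified Lean document; each statement's English description precedes it below -/
import Mathlib

section
/- Let L be a join-semilattice with finite connected decompositions and let (A, B) be a finite duality in L with B nonempty. Then the map M ↦ r(M) is a bijection from the set of transversals of A onto B. -/
open Set

/-- `upSet M = {x | ∃ m ∈ M, m ≤ x}`. -/
def upSet {L : Type*} [Preorder L] (M : Set L) : Set L := {x | ∃ m ∈ M, m ≤ x}

/-- `downSet M = {x | ∃ m ∈ M, x ≤ m}`. -/
def downSet {L : Type*} [Preorder L] (M : Set L) : Set L := {x | ∃ m ∈ M, x ≤ m}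

/-- A finite duality `(A, B)`: finite antichains such that
`x ∈ ↑A` iff `x ∉ ↓B`. -/
def FiniteDuality {L : Type*} [Preorder L] (A B : Set L) : Prop :=
  A.Finite ∧ B.Finite ∧ IsAntichain (· ≤ ·) A ∧ IsAntichain (· ≤ ·) B ∧
    ∀ x : L, (∃ a ∈ A, a ≤ x) ↔ ¬ ∃ b ∈ B, x ≤ b

/-- `(l, r)` is a duality pair if `¬ l ≤ x ↔ x ≤ r` for all `x`. -/
def DualityPair {L : Type*} [Preorder L] (l r : L) : Prop :=
  ∀ x : L, ¬ l ≤ x ↔ x ≤ r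

/-- An element is connected (join-prime) if `a ≤ b ⊔ c` implies `a ≤ b` or `a ≤ c`. -/
def ConnectedElt {L : Type*} [SemilatticeSup L] (a : L) : Prop :=
  ∀ b c : L, a ≤ b ⊔ c → a ≤ b ∨ a ≤ c

/-- `L` has finite connected decompositions: every element is the supremum of a
finite nonempty set of connected elements. -/
def HasFiniteConnectedDecompositions (L : Type*) [SemilatticeSup L] : Prop :=
  ∀ a : L, ∃ (F : Finset L) (h : F.Nonempty),
    (∀ c ∈ F, ConnectedElt c) ∧ F.sup' h id = a

/-- `c` is a connected component of `a`: `c` is connected and either `c = a` or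
there is `b` with `a = b ⊔ c ≠ b`. -/
def IsConnComponent {L : Type*} [SemilatticeSup L] (c a : L) : Prop :=
  ConnectedElt c ∧ (c = a ∨ ∃ b : L, a = b ⊔ c ∧ b ⊔ c ≠ b)

/-- `connComponents A` is the set of connected components of elements of `A`. -/
def connComponents {L : Type*} [SemilatticeSup L] (A : Set L) : Set L :=
  {c | ∃ a ∈ A, IsConnComponent c a}

/-- A quasitransversal of `A`: an antichain `M ⊆ A_Cn` with `A ⊆ ↑M`. -/
def IsQuasitransversal {L : Type*} [SemilatticeSup L] (M A : Set L) : Prop :=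
  M ⊆ connComponents A ∧ IsAntichain (· ≤ ·) M ∧ A ⊆ upSet M

/-- A transversal of `A`: a quasitransversal maximal in the refinement order
`M ⊴ N ↔ N ⊆ ↑M`. -/
def IsTransversal {L : Type*} [SemilatticeSup L] (M A : Set L) : Prop :=
  IsQuasitransversal M A ∧
    ∀ N : Set L, IsQuasitransversal N A → N ⊆ upSet M → N = M

/-- The set of weak left duals: elements of `A` for some finite duality `(A, B)`
with `B` nonempty. -/
def wld (L : Type*) [Preorder L] : Set L :=
  {a | ∃ A B : Set L, FiniteDuality A B ∧ B.Nonempty ∧ a ∈ A}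

/-- The sparse incomparability axiom. -/
def SIA (L : Type*) [Preorder L] : Prop :=
  ∀ (x : L) (M U : Set L), M.Finite → U.Finite →
    (insert x (upSet U)) ∩ wld L = ∅ →
    ∃ y : L, y ∉ wld L ∧ y ≤ x ∧ y ∉ upSet (insert x U) ∧
      ∀ m ∈ M, (y ≤ m ↔ x ≤ m)

section ConnectedComponents

variable {L : Type*} [SemilatticeSup L]

theorem ConnectedElt.exists_le_of_le_sup' {c : L} (hc : ConnectedElt c) {F : Finset L}
    (hF : F.Nonempty) (h : c ≤ F.sup' hF id) : ∃ f ∈ F, c ≤ f := by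
  induction hF using Finset.Nonempty.cons_induction with
  | singleton a => exact ⟨a, by simp, by simpa using h⟩
  | cons a s ha hs ih =>
    rw [Finset.sup'_cons hs] at h
    rcases hc _ _ h with h | h
    · exact ⟨a, by simp, h⟩
    · obtain ⟨f, hf, hcf⟩ := ih h
      exact ⟨f, by simp [hf], hcf⟩

theorem IsConnComponent.le {c a : L} (h : IsConnComponent c a) : c ≤ a := by
  rcases h.2 with rfl | ⟨b, rfl, -⟩
  · exact le_rfl
  · exact le_sup_right

/-- Every connected component of `a` occurs in each finite connected decomposition of `a`. -/
theorem IsConnComponent.mem_of_sup'_eq {c a : L} (h : IsConnComponent c a) {F : Finset L}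
    (hF : F.Nonempty) (hconn : ∀ f ∈ F, ConnectedElt f) (ha : F.sup' hF id = a) : c ∈ F := by
  obtain ⟨f, hf, hcf⟩ := h.1.exists_le_of_le_sup' hF (ha ▸ h.le)
  have hfa : f ≤ a := ha ▸ Finset.le_sup' id hf
  suffices f ≤ c from le_antisymm hcf this ▸ hf
  rcases h.2 with rfl | ⟨b, rfl, hb⟩
  · exact hfa
  · exact (hconn f hf b c hfa).resolve_left fun hfb => hb (sup_eq_left.2 (hcf.trans hfb))

theorem isConnComponent_of_maximal {F : Finset L} (hF : F.Nonempty) {m : L}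
    (hconn : ConnectedElt m) (hm : Maximal (· ∈ F) m) :
    IsConnComponent m (F.sup' hF id) := by
  classical
  refine ⟨hconn, ?_⟩
  rcases (F.erase m).eq_empty_or_nonempty with he | he
  · left
    refine le_antisymm (Finset.le_sup' id hm.prop) (Finset.sup'_le _ _ fun f hf => ?_)
    by_contra hfm
    have : f ∈ F.erase m := Finset.mem_erase.2 ⟨fun h => hfm h.le, hf⟩
    simp [he] at this
  · right
    refine ⟨(F.erase m).sup' he id, le_antisymm ?_ (sup_le ?_ ?_), fun h => ?_⟩
    · refine Finset.sup'_le _ _ fun f hf => ?_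
      by_cases hfm : f = m
      · subst hfm
        exact le_sup_right
      · exact (Finset.le_sup' id (Finset.mem_erase.2 ⟨hfm, hf⟩)).trans le_sup_left
    · exact Finset.sup'_mono _ (Finset.erase_subset _ _) he
    · exact Finset.le_sup' id hm.prop
    · obtain ⟨f, hf, hmf⟩ := hconn.exists_le_of_le_sup' he (sup_eq_left.1 h)
      obtain ⟨hne, hfF⟩ := Finset.mem_erase.1 hf
      exact hne (le_antisymm (hm.le_of_ge hfF hmf) hmf)

theorem HasFiniteConnectedDecompositions.le_of_forall_component_le
    (hL : HasFiniteConnectedDecompositions L) {a x : L}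
    (h : ∀ c, IsConnComponent c a → c ≤ x) : a ≤ x := by
  obtain ⟨F, hF, hconn, rfl⟩ := hL a
  refine Finset.sup'_le _ _ fun f hf => ?_
  obtain ⟨m, hfm, hm⟩ := F.exists_le_maximal hf
  exact hfm.trans (h m (isConnComponent_of_maximal hF (hconn m hm.prop) hm))

theorem HasFiniteConnectedDecompositions.finite_connComponents
    (hL : HasFiniteConnectedDecompositions L) {A : Set L} (hA : A.Finite) :
    (connComponents A).Finite := by
  have : connComponents A = ⋃ a ∈ A, {c | IsConnComponent c a} := by
    ext c
    simp [connComponents]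
  rw [this]
  refine hA.biUnion fun a _ => ?_
  obtain ⟨F, hF, hconn, ha⟩ := hL a
  exact F.finite_toSet.subset fun c hc => hc.mem_of_sup'_eq hF hconn ha

end ConnectedComponents

section Transversals

variable {L : Type*} [SemilatticeSup L] {A B : Set L}

theorem IsAntichain.eq_of_subset_upSet {M N : Set L} (hM : IsAntichain (· ≤ ·) M)
    (hN : IsAntichain (· ≤ ·) N) (hMN : M ⊆ upSet N) (hNM : N ⊆ upSet M) : M = N := by
  have key : ∀ {P Q : Set L}, IsAntichain (· ≤ ·) P → P ⊆ upSet Q → Q ⊆ upSet P → P ⊆ Q := by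
    intro P Q hP hPQ hQP p hp
    obtain ⟨q, hq, hqp⟩ := hPQ hp
    obtain ⟨p', hp', hpq⟩ := hQP hq
    have : p' = p := hP.eq hp' hp (hpq.trans hqp)
    exact le_antisymm hqp (this ▸ hpq) ▸ hq
  exact (key hM hMN hNM).antisymm (key hN hNM hMN)

/-- The minimal connected components of elements of `A` that do not lie below `b`. -/
def minimalComponentsNotLE (A : Set L) (b : L) : Set L :=
  {c | Minimal (fun c => c ∈ connComponents A ∧ ¬ c ≤ b) c}

theorem mem_and_not_le_of_mem_minimalComponentsNotLE {b c : L}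
    (hc : c ∈ minimalComponentsNotLE A b) : c ∈ connComponents A ∧ ¬ c ≤ b :=
  Minimal.prop (P := fun c => c ∈ connComponents A ∧ ¬ c ≤ b) hc

theorem not_le_of_mem_upSet_minimalComponentsNotLE {b c : L}
    (hc : c ∈ upSet (minimalComponentsNotLE A b)) : ¬ c ≤ b := by
  obtain ⟨m, hm, hmc⟩ := hc
  exact fun h => (mem_and_not_le_of_mem_minimalComponentsNotLE hm).2 (hmc.trans h)

theorem mem_upSet_minimalComponentsNotLE (hL : HasFiniteConnectedDecompositions L)
    (hA : A.Finite) {b c : L} (hc : c ∈ connComponents A) (hcb : ¬ c ≤ b) :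
    c ∈ upSet (minimalComponentsNotLE A b) := by
  have hfin : {c | c ∈ connComponents A ∧ ¬ c ≤ b}.Finite :=
    (hL.finite_connComponents hA).subset fun _ h => h.1
  obtain ⟨m, hmc, hm⟩ := hfin.exists_le_minimal (a := c) ⟨hc, hcb⟩
  exact ⟨m, hm, hmc⟩

theorem FiniteDuality.not_le (hAB : FiniteDuality A B) {a b : L} (ha : a ∈ A) (hb : b ∈ B) :
    ¬ a ≤ b :=
  fun h => (hAB.2.2.2.2 b).1 ⟨a, ha, h⟩ ⟨b, hb, le_rfl⟩

theorem FiniteDuality.exists_le_of_forall_not_le (hAB : FiniteDuality A B) {x : L}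
    (h : ∀ a ∈ A, ¬ a ≤ x) : ∃ b ∈ B, x ≤ b := by
  by_contra hx
  obtain ⟨a, ha, hax⟩ := (hAB.2.2.2.2 x).2 hx
  exact h a ha hax

theorem FiniteDuality.isQuasitransversal_minimalComponentsNotLE
    (hL : HasFiniteConnectedDecompositions L) (hAB : FiniteDuality A B) {b : L} (hb : b ∈ B) :
    IsQuasitransversal (minimalComponentsNotLE A b) A := by
  refine ⟨fun c hc => (mem_and_not_le_of_mem_minimalComponentsNotLE hc).1,
    setOfPred_minimal_antichain _, fun a ha => ?_⟩
  have : ∃ c, IsConnComponent c a ∧ ¬ c ≤ b := by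
    by_contra! h
    exact hAB.not_le ha hb (hL.le_of_forall_component_le h)
  obtain ⟨c, hc, hcb⟩ := this
  obtain ⟨m, hm, hmc⟩ := mem_upSet_minimalComponentsNotLE hL hAB.1 ⟨a, ha, hc⟩ hcb
  exact ⟨m, hm, hmc.trans hc.le⟩

/-- The components outside the up-closure of a quasitransversal have a common bound in `B`. -/
theorem IsQuasitransversal.exists_bound (hL : HasFiniteConnectedDecompositions L)
    (hAB : FiniteDuality A B) (hB : B.Nonempty) {M : Set L} (hM : IsQuasitransversal M A) :
    ∃ b ∈ B, ∀ c ∈ connComponents A, c ∉ upSet M → c ≤ b := by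
  have hfin : (connComponents A \ upSet M).Finite := (hL.finite_connComponents hAB.1).sdiff
  rcases hfin.toFinset.eq_empty_or_nonempty with he | he
  · obtain ⟨b, hb⟩ := hB
    refine ⟨b, hb, fun c hc hcM => ?_⟩
    have : c ∈ hfin.toFinset := hfin.mem_toFinset.2 ⟨hc, hcM⟩
    simp [he] at this
  · obtain ⟨b, hb, hle⟩ := hAB.exists_le_of_forall_not_le (x := hfin.toFinset.sup' he id) <| by
      intro a ha hax
      obtain ⟨m, hm, hma⟩ := hM.2.2 ha
      obtain ⟨_, _, hmconn⟩ := hM.1 hm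
      obtain ⟨c, hc, hmc⟩ := hmconn.1.exists_le_of_le_sup' he (hma.trans hax)
      exact (hfin.mem_toFinset.1 hc).2 ⟨m, hm, hmc⟩
    exact ⟨b, hb, fun c hc hcM =>
      (Finset.le_sup' id (hfin.mem_toFinset.2 ⟨hc, hcM⟩)).trans hle⟩

theorem IsTransversal.eq_minimalComponentsNotLE (hL : HasFiniteConnectedDecompositions L)
    (hAB : FiniteDuality A B) {M : Set L} (hM : IsTransversal M A) {b : L} (hb : b ∈ B)
    (h : ∀ c ∈ connComponents A, c ∉ upSet M → c ≤ b) : minimalComponentsNotLE A b = M := by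
  refine hM.2 _ (hAB.isQuasitransversal_minimalComponentsNotLE hL hb) fun c hc => ?_
  by_contra hcM
  obtain ⟨hcA, hcb⟩ := mem_and_not_le_of_mem_minimalComponentsNotLE hc
  exact hcb (h c hcA hcM)

theorem FiniteDuality.eq_of_forall_component_le (hL : HasFiniteConnectedDecompositions L)
    (hAB : FiniteDuality A B) {b b' : L} (hb : b ∈ B) (hb' : b' ∈ B)
    (h : ∀ c ∈ connComponents A, c ≤ b → c ≤ b') : b = b' := by
  obtain ⟨d, hd, hle⟩ := hAB.exists_le_of_forall_not_le (x := b ⊔ b') fun a ha hle =>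
    hAB.not_le ha hb' <| hL.le_of_forall_component_le fun c hc =>
      (hc.1 b b' (hc.le.trans hle)).elim (h c ⟨a, ha, hc⟩) id
  have hanti : IsAntichain (· ≤ ·) B := hAB.2.2.2.1
  exact (hanti.eq hb hd (le_sup_left.trans hle)).trans
    (hanti.eq hb' hd (le_sup_right.trans hle)).symm

theorem FiniteDuality.isTransversal_minimalComponentsNotLE
    (hL : HasFiniteConnectedDecompositions L) (hAB : FiniteDuality A B) {b : L} (hb : b ∈ B) :
    IsTransversal (minimalComponentsNotLE A b) A := by
  have hq := hAB.isQuasitransversal_minimalComponentsNotLE hL hb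
  refine ⟨hq, fun N hN hNM => hN.2.1.eq_of_subset_upSet hq.2.1 hNM fun c hc => ?_⟩
  obtain ⟨b', hb', hbound⟩ := hN.exists_bound hL hAB ⟨b, hb⟩
  obtain rfl : b = b' := hAB.eq_of_forall_component_le hL hb hb' fun d hd hdb =>
    hbound d hd fun ⟨n, hn, hnd⟩ =>
      not_le_of_mem_upSet_minimalComponentsNotLE (hNM hn) (hnd.trans hdb)
  by_contra hcN
  obtain ⟨hcA, hcb⟩ := mem_and_not_le_of_mem_minimalComponentsNotLE hc
  exact hcb (hbound c hcA hcN)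

end Transversals

/-- the map `M ↦ r(M)` is a bijection from the transversals of `A`
onto `B`. -/
theorem transversals_biject_with_B {L : Type*} [SemilatticeSup L]
    (hL : HasFiniteConnectedDecompositions L) (A B : Set L)
    (hAB : FiniteDuality A B) (hB : B.Nonempty) :
    ∃ f : {M : Set L // IsTransversal M A} → B,
      (∀ M : {M : Set L // IsTransversal M A},
        M.1 ∩ downSet {(f M : L)} = ∅ ∧
        connComponents A \ upSet M.1 ⊆ downSet {(f M : L)}) ∧
      Function.Bijective f := by
  choose r hrB hr using fun M : {M : Set L // IsTransversal M A} =>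
    M.2.1.exists_bound hL hAB hB
  have hM : ∀ M : {M : Set L // IsTransversal M A}, minimalComponentsNotLE A (r M) = M.1 :=
    fun M => M.2.eq_minimalComponentsNotLE hL hAB (hrB M) (hr M)
  refine ⟨fun M => ⟨r M, hrB M⟩, fun M => ⟨?_, ?_⟩, fun M N hMN => ?_, fun b => ?_⟩
  · rw [Set.eq_empty_iff_forall_notMem]
    rintro c ⟨hc, _, rfl, hle⟩
    rw [← hM M] at hc
    exact (mem_and_not_le_of_mem_minimalComponentsNotLE hc).2 hle
  · exact fun c hc => ⟨r M, rfl, hr M c hc.1 hc.2⟩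
  · have hrMN : r M = r N := congrArg Subtype.val hMN
    exact Subtype.ext (by rw [← hM M, ← hM N, hrMN])
  · refine ⟨⟨_, hAB.isTransversal_minimalComponentsNotLE hL b.2⟩, Subtype.ext ?_⟩
    exact (hAB.eq_of_forall_component_le hL b.2 (hrB _) fun c hc hcb =>
      hr _ c hc fun h => not_le_of_mem_upSet_minimalComponentsNotLE h hcb).symm
end

section
/- Let L be a Heyting algebra with finite connected decompositions and let a ∈ L. Then the following are equivalent: (1) a is a weak left dual, i.e., a ∈ A for some finite duality (A, B) in L with B nonempty; (2) a is the supremum of a finite nonempty set of left duals. -/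
open Set

/-- Every finite set contains an irredundant subset with the same supremum. -/
theorem exists_irredundant_subset {L : Type*} [SemilatticeSup L] [OrderBot L] [DecidableEq L]
    (F : Finset L) :
    ∃ G ⊆ F, G.sup id = F.sup id ∧ ∀ c ∈ G, ¬ c ≤ (G.erase c).sup id := by
  induction F using Finset.strongInduction with
  | H F ih =>
    by_cases h : ∃ c ∈ F, c ≤ (F.erase c).sup id
    · obtain ⟨c, hc, hle⟩ := h
      obtain ⟨G, hG, hsup, hirr⟩ := ih _ (Finset.erase_ssubset hc)
      refine ⟨G, hG.trans (Finset.erase_subset _ _), hsup.trans ?_, hirr⟩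
      rw [← Finset.insert_erase hc, Finset.sup_insert, Finset.erase_insert_eq_erase,
        Finset.erase_idem]
      exact (sup_eq_right.2 hle).symm
    · push Not at h
      exact ⟨F, subset_rfl, rfl, h⟩

/-- A nonzero connected element below a finite supremum is below one of its members. -/
theorem ConnectedElt.exists_le_of_le_sup {L ι : Type*} [SemilatticeSup L] [OrderBot L] {c : L}
    (hc : ConnectedElt c) (hbot : c ≠ ⊥) {s : Finset ι} {f : ι → L} (h : c ≤ s.sup f) :
    ∃ i ∈ s, c ≤ f i := by
  classical
  induction s using Finset.induction_on with
  | empty => exact absurd (le_bot_iff.1 (by simpa using h)) hbot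
  | insert i s _ ih =>
    rw [Finset.sup_insert] at h
    rcases hc _ _ h with h | h
    · exact ⟨i, Finset.mem_insert_self _ _, h⟩
    · obtain ⟨j, hj, hle⟩ := ih h
      exact ⟨j, Finset.mem_insert_of_mem hj, hle⟩

/-- An irredundant connected joinand of a member of the left side of a finite duality
is a left dual. -/
theorem FiniteDuality.exists_dualityPair {L : Type*} [HeytingAlgebra L] {A B : Set L}
    (hAB : FiniteDuality A B) {c d : L} (ha : c ⊔ d ∈ A) (hc : ConnectedElt c)
    (hcd : ¬ c ≤ d) : ∃ r : L, DualityPair c r := by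
  classical
  obtain ⟨-, hB, hA, -, hdual⟩ := hAB
  refine ⟨(hB.toFinset.filter (d ≤ ·)).sup (c ⇨ ·), fun x => ⟨fun hx => ?_, fun hx hcx => ?_⟩⟩
  · have hnot : ¬ ∃ a ∈ A, a ≤ x ⊓ c ⊔ d := by
      rintro ⟨a, haA, hle⟩
      have heq : a = c ⊔ d := hA.eq haA ha (hle.trans (sup_le_sup_right inf_le_right d))
      rcases hc _ _ (le_sup_left.trans (heq ▸ hle)) with h | h
      · exact hx (h.trans inf_le_left)
      · exact hcd h
    rw [hdual, not_not] at hnot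
    obtain ⟨b, hb, hle⟩ := hnot
    have hmem : b ∈ hB.toFinset.filter (d ≤ ·) := by
      simpa using ⟨hb, le_sup_right.trans hle⟩
    exact (le_himp_iff.2 (le_sup_left.trans hle)).trans (Finset.le_sup (f := (c ⇨ ·)) hmem)
  · obtain ⟨b, hb, hle⟩ :=
      hc.exists_le_of_le_sup (fun h => hcd (h ▸ bot_le)) (hcx.trans hx)
    simp only [Finset.mem_filter, Set.Finite.mem_toFinset] at hb
    exact (hdual b).1 ⟨_, ha, sup_le (by simpa using hle) hb.2⟩ ⟨b, hb.1, le_rfl⟩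

/-- A finite nonempty supremum of left duals is a weak left dual. -/
theorem finset_sup_mem_wld {L : Type*} [SemilatticeSup L] {F : Finset L} (h : F.Nonempty)
    (hF : ∀ x ∈ F, ∃ r : L, DualityPair x r) : F.sup' h id ∈ wld L := by
  choose! r hr using hF
  have hfin : (r '' (F : Set L)).Finite := F.finite_toSet.image r
  have hmax : {b | Maximal (· ∈ r '' (F : Set L)) b}.Finite := hfin.subset fun b hb => hb.prop
  refine ⟨{F.sup' h id}, {b | Maximal (· ∈ r '' (F : Set L)) b},
    ⟨Set.finite_singleton _, hmax, Set.subsingleton_singleton.isAntichain _,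
      setOfPred_maximal_antichain _, fun x => ?_⟩, ?_, rfl⟩
  · simp only [Set.mem_singleton_iff, exists_eq_left, Finset.sup'_le_iff, id]
    constructor
    · rintro hx ⟨b, hb, hxb⟩
      obtain ⟨l, hl, rfl⟩ := hb.prop
      exact (hr l hl x).2 hxb (hx l hl)
    · intro hx l hl
      by_contra hlx
      obtain ⟨b, hle, hb⟩ := hfin.exists_le_maximal (Set.mem_image_of_mem r hl)
      exact hx ⟨b, hb, ((hr l hl x).1 hlx).trans hle⟩
  · obtain ⟨l, hl⟩ := h
    obtain ⟨b, -, hb⟩ := hfin.exists_le_maximal (Set.mem_image_of_mem r hl)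
    exact ⟨b, hb⟩

/-- `a` is a weak left dual iff `a` is the supremum of a finite
nonempty set of left duals. -/
theorem weakLeftDual_iff_join_of_leftDuals {L : Type*} [HeytingAlgebra L]
    (hL : HasFiniteConnectedDecompositions L) (a : L) :
    a ∈ wld L ↔ ∃ (F : Finset L) (h : F.Nonempty),
      (∀ x ∈ F, ∃ rx : L, DualityPair x rx) ∧ F.sup' h id = a := by
  classical
  constructor
  · rintro ⟨A, B, hAB, ⟨b, hb⟩, ha⟩
    have hbot : a ≠ ⊥ := by
      rintro rfl
      exact (hAB.2.2.2.2 b).1 ⟨⊥, ha, bot_le⟩ ⟨b, hb, le_rfl⟩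
    obtain ⟨F, hF, hconn, hsup⟩ := hL a
    obtain ⟨G, hGF, hG, hirr⟩ := exists_irredundant_subset F
    rw [← Finset.sup'_eq_sup hF, hsup] at hG
    have hne : G.Nonempty := by
      rw [Finset.nonempty_iff_ne_empty]
      rintro rfl
      exact hbot (by simpa using hG.symm)
    refine ⟨G, hne, fun c hc => ?_, (Finset.sup'_eq_sup hne id).trans hG⟩
    refine hAB.exists_dualityPair (d := (G.erase c).sup id) ?_ (hconn c (hGF hc)) (hirr c hc)
    have hcd : c ⊔ (G.erase c).sup id = a := by
      rw [← hG]
      conv_rhs => rw [← Finset.insert_erase hc, Finset.sup_insert, id]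
    rwa [hcd]
  · rintro ⟨F, h, hF, rfl⟩
    exact finset_sup_mem_wld h hF
end
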